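/- arXiv:2304.00586 — 5 statements merged into one kernel-verified Lean document; each statement's English description precedes it below -/
import Mathlib

section
/- Let G be a directed acyclic graph on the labeled vertex set V = {1, 2, …, n} with minimal source sequence u_1, u_2, …, u_n and encoding S_1, S_2, …, S_{n-1}, and set S_0 = ∅. Then u_1 is the smallest-label vertex of V \ (⋃_{i=0}^{n-1} S_i), and for every 2 ≤ j ≤ n, u_j is the smallest-label vertex of V \ ({u_1, …, u_{j-1}} ∪ ⋃_{i=0}^{n-j} S_i). -/
/-- A directed graph on vertex set `Fin n` (a relation `E`) is a DAG iff its
transitive closure is irreflexive, i.e. it has no directed cycle. -/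
def IsDag {n : ℕ} (E : Fin n → Fin n → Prop) : Prop :=
  ∀ v : Fin n, ¬ Relation.TransGen E v v

/-- `u` (used with 1-based indices `1, …, n`) is the minimal source sequence of `E`:
for each `1 ≤ i ≤ n`, `u i` is the least vertex that is a source of the subgraph
induced on the vertices remaining after deleting `u 1, …, u (i-1)`. -/
def IsMinSourceSeq {n : ℕ} (E : Fin n → Fin n → Prop) (u : ℕ → Fin n) : Prop :=
  ∀ i : ℕ, 1 ≤ i → i ≤ n →
    IsLeast {v : Fin n |
      (∀ j : ℕ, 1 ≤ j → j < i → v ≠ u j) ∧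
      ∀ w : Fin n, (∀ j : ℕ, 1 ≤ j → j < i → w ≠ u j) → ¬ E w v} (u i)

/-- `S` (used with indices `0, …, n-1`) is the encoding of the DAG `E` with minimal
source sequence `u`: for every `1 ≤ i ≤ n`, `S (n - i)` is the set of out-neighbors
of `u i` in `E` (so `S 0 = ∅` always, and the encoding proper is `S 1, …, S (n-1)`). -/
def IsEncoding {n : ℕ} (E : Fin n → Fin n → Prop) (u : ℕ → Fin n)
    (S : ℕ → Finset (Fin n)) : Prop :=
  IsMinSourceSeq E u ∧
    ∀ i : ℕ, 1 ≤ i → i ≤ n → ∀ v : Fin n, v ∈ S (n - i) ↔ E (u i) v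

/-- The terms of a minimal source sequence exhaust the vertex set. -/
theorem IsMinSourceSeq.exists_eq {n : ℕ} {E : Fin n → Fin n → Prop} {u : ℕ → Fin n}
    (hu : IsMinSourceSeq E u) (v : Fin n) : ∃ i : ℕ, 1 ≤ i ∧ i ≤ n ∧ u i = v := by
  have hne : ∀ i j : ℕ, 1 ≤ i → i < j → j ≤ n → u j ≠ u i := fun i j hi hij hj =>
    (hu j (by omega) hj).1.1 i hi hij
  have hinj : Function.Injective fun i : Fin n => u (i + 1) := by
    intro a b hab
    rcases lt_trichotomy a b with h | h | h
    · exact absurd hab.symm (hne _ _ (by omega) (by omega) (by omega))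
    · exact h
    · exact absurd hab (hne _ _ (by omega) (by omega) (by omega))
  obtain ⟨i, hi⟩ := Finite.surjective_of_injective hinj v
  exact ⟨i + 1, by omega, by omega, hi⟩

/-- Every `u j` is the least vertex outside `u 1, …, u (j-1)` and `⋃_{i=0}^{n-j} S i`. -/
theorem IsEncoding.isLeast {n : ℕ} {E : Fin n → Fin n → Prop} {u : ℕ → Fin n}
    {S : ℕ → Finset (Fin n)} (h : IsEncoding E u S) {j : ℕ} (hj : 1 ≤ j) (hjn : j ≤ n) :
    IsLeast {v : Fin n |
      (∀ i : ℕ, 1 ≤ i → i < j → v ≠ u i) ∧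
      v ∉ (Finset.range (n - j + 1)).biUnion S} (u j) := by
  obtain ⟨hu, hS⟩ := h
  convert hu j hj hjn using 1
  ext v
  refine and_congr_right fun _ => ?_
  simp only [Finset.mem_biUnion, Finset.mem_range, not_exists, not_and]
  constructor
  · intro hv w hw hE
    obtain ⟨i, hi, hin, rfl⟩ := hu.exists_eq w
    have hji : j ≤ i := not_lt.mp fun hij => hw i hi hij rfl
    exact hv (n - i) (by omega) ((hS i hi hin v).2 hE)
  · intro hv k hk hmem
    have hE : E (u (n - k)) v := by
      rw [← hS (n - k) (by omega) (by omega), Nat.sub_sub_self (by omega)]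
      exact hmem
    exact hv _ (fun i hi hij => (hu (n - k) (by omega) (by omega)).1.1 i hi (by omega)) hE

/-- Let `G` be a DAG on `V = {1,…,n}` with minimal source sequence
`u 1, …, u n` and encoding `S 1, …, S (n-1)`, and set `S 0 = ∅`. Then `u 1` is the
smallest-label vertex of `V` minus `⋃_{i=0}^{n-1} S i`, and for every `2 ≤ j ≤ n`,
`u j` is the smallest-label vertex of `V` minus `{u 1, …, u (j-1)} ∪ ⋃_{i=0}^{n-j} S i`. -/
theorem minimal_source_sequence_from_encoding {n : ℕ}
    (E : Fin n → Fin n → Prop) (u : ℕ → Fin n) (S : ℕ → Finset (Fin n))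
    (hdag : IsDag E) (henc : IsEncoding E u S) (hS0 : S 0 = ∅) :
    IsLeast {v : Fin n | v ∉ (Finset.range n).biUnion S} (u 1) ∧
    ∀ j : ℕ, 2 ≤ j → j ≤ n →
      IsLeast {v : Fin n |
        (∀ i : ℕ, 1 ≤ i → i < j → v ≠ u i) ∧
        v ∉ (Finset.range (n - j + 1)).biUnion S} (u j) := by
  have hn : 1 ≤ n := (u 1).pos
  refine ⟨?_, fun j hj hjn => henc.isLeast (by omega) hjn⟩
  have h := henc.isLeast le_rfl hn
  rw [Nat.sub_add_cancel hn] at h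
  convert h using 1
  ext v
  exact ⟨fun hv => ⟨fun i hi hlt => by omega, hv⟩, And.right⟩
end

section
/- Let G be a directed acyclic graph on the labeled vertex set V = {1, 2, …, n} and let S_1, S_2, …, S_{n-1} be its encoding. Then the encoding satisfies |⋃_{i=1}^{k} S_i| ≤ k for every 1 ≤ k ≤ n−1. -/
/-- Distinct indices in `1, …, n` give distinct vertices of a minimal source sequence. -/
theorem IsMinSourceSeq.injOn {n : ℕ} {E : Fin n → Fin n → Prop} {u : ℕ → Fin n}
    (hu : IsMinSourceSeq E u) : Set.InjOn u (Set.Icc 1 n) := by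
  intro i hi j hj hij
  rcases lt_trichotomy i j with h | h | h
  · exact absurd hij.symm ((hu j hj.1 hj.2).1.1 i hi.1 h)
  · exact h
  · exact absurd hij ((hu i hi.1 hi.2).1.1 j hj.1 h)

/-- No edge goes weakly backwards along a minimal source sequence. -/
theorem IsMinSourceSeq.not_edge_of_le {n : ℕ} {E : Fin n → Fin n → Prop} {u : ℕ → Fin n}
    (hu : IsMinSourceSeq E u) {j m : ℕ} (hj : 1 ≤ j) (hjm : j ≤ m) (hm : m ≤ n) :
    ¬ E (u m) (u j) :=
  (hu j hj (hjm.trans hm)).1.2 _ fun l hl hlj =>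
    (hu m (hj.trans hjm) hm).1.1 l hl (hlj.trans_le hjm)

/-- The encoding `S 1, …, S (n-1)` of a DAG on `{1,…,n}` satisfies
`|⋃_{i=1}^{k} S i| ≤ k` for every `1 ≤ k ≤ n-1`. -/
theorem encoding_union_card_le {n : ℕ}
    (E : Fin n → Fin n → Prop) (u : ℕ → Fin n) (S : ℕ → Finset (Fin n))
    (hdag : IsDag E) (henc : IsEncoding E u S) :
    ∀ k : ℕ, 1 ≤ k → k ≤ n - 1 → ((Finset.Icc 1 k).biUnion S).card ≤ k := by
  obtain ⟨hu, hS⟩ := henc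
  intro k hk hkn
  have hsub : (Finset.Icc 1 k).biUnion S ⊆ ((Finset.Icc 1 (n - k)).image u)ᶜ := by
    intro v hv
    simp only [Finset.mem_biUnion, Finset.mem_Icc] at hv
    obtain ⟨i, ⟨hi, hik⟩, hv⟩ := hv
    simp only [Finset.mem_compl, Finset.mem_image, Finset.mem_Icc]
    rintro ⟨j, ⟨hj, hjk⟩, rfl⟩
    have hE := hS (n - i) (by omega) (by omega) (u j)
    rw [show n - (n - i) = i by omega] at hE
    exact hu.not_edge_of_le hj (by omega) (by omega) (hE.1 hv)
  have hinj : Set.InjOn u (Finset.Icc 1 (n - k)) := hu.injOn.mono fun i hi => by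
    simp only [Finset.coe_Icc, Set.mem_Icc] at hi ⊢
    omega
  refine (Finset.card_le_card hsub).trans ?_
  rw [Finset.card_compl, Finset.card_image_of_injOn hinj, Fintype.card_fin, Nat.card_Icc]
  omega
end

section
/- Let S_1, …, S_{n-1} be a sequence of subsets of V = {1, 2, …, n} satisfying |⋃_{i=1}^{k} S_i| ≤ k for every 1 ≤ k ≤ n−1. Then there exists a directed acyclic graph G on the labeled vertex set V whose encoding is exactly S_1, …, S_{n-1}. -/
/-- Given sets `T 1, T 2, …`, the sequence (from index `1`) which greedily picks the least vertex
outside `T i` that has not been picked before; `d` is the default when there is none. -/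
def greedySeq {n : ℕ} (T : ℕ → Finset (Fin n)) (d : Fin n) (i : ℕ) : Fin n :=
  let A := (T i ∪ (Finset.Ico 1 i).attach.image fun j => greedySeq T d j.1)ᶜ
  if h : A.Nonempty then A.min' h else d
termination_by i
decreasing_by exact (Finset.mem_Ico.mp j.2).2

theorem isLeast_greedySeq {n : ℕ} {T : ℕ → Finset (Fin n)} (d : Fin n) {i : ℕ}
    (hi : 1 ≤ i) (hin : i ≤ n) (hT : (T i).card ≤ n - i) :
    IsLeast {v | (∀ j, 1 ≤ j → j < i → v ≠ greedySeq T d j) ∧ v ∉ T i} (greedySeq T d i) := by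
  set A := (T i ∪ (Finset.Ico 1 i).attach.image fun j => greedySeq T d j.1)ᶜ with hA
  have hcard : A.Nonempty := by
    rw [← Finset.card_pos, hA, Finset.card_compl, Fintype.card_fin]
    have h₁ := Finset.card_union_le (T i)
      ((Finset.Ico 1 i).attach.image fun j => greedySeq T d j.1)
    have h₂ : ((Finset.Ico 1 i).attach.image fun j => greedySeq T d j.1).card ≤ i - 1 :=
      Finset.card_image_le.trans (by simp)
    omega
  have hval : greedySeq T d i = A.min' hcard := by
    rw [greedySeq]
    exact dif_pos hcard
  have hset : {v | (∀ j, 1 ≤ j → j < i → v ≠ greedySeq T d j) ∧ v ∉ T i} = (A : Set (Fin n)) := by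
    ext v
    simp only [hA, Set.mem_ofPred_eq, Finset.mem_coe, Finset.mem_compl, Finset.mem_union,
      Finset.mem_image, Finset.mem_attach, true_and, Subtype.exists, Finset.mem_Ico]
    grind
  rw [hset, hval]
  exact A.isLeast_min' hcard

/-- A sequence of `n` pairwise distinct vertices of `Fin n` exhausts `Fin n`. -/
theorem exists_eq_of_pairwise_ne {n : ℕ} {u : ℕ → Fin n}
    (hu : ∀ i j, 1 ≤ j → j < i → i ≤ n → u i ≠ u j) (v : Fin n) :
    ∃ i, 1 ≤ i ∧ i ≤ n ∧ v = u i := by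
  have hinj : Function.Injective fun k : Fin n => u (k + 1) := by
    intro a b hab
    rcases lt_trichotomy a b with h | h | h
    · exact absurd hab.symm (hu _ _ (by omega) (by omega) (by omega))
    · exact h
    · exact absurd hab (hu _ _ (by omega) (by omega) (by omega))
  obtain ⟨k, hk⟩ := Finite.surjective_of_injective hinj v
  exact ⟨k + 1, by omega, by omega, hk.symm⟩

/-- A relation that strictly increases a rank function has no directed cycle. -/
theorem IsDag.of_rank {n : ℕ} {E : Fin n → Fin n → Prop} (r : Fin n → ℕ)
    (hr : ∀ x y, E x y → r x < r y) : IsDag E := by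
  intro v hv
  have h : Relation.TransGen (· < ·) (r v) (r v) := hv.lift r hr
  rw [Relation.transGen_eq_self] at h
  exact lt_irrefl _ h

/-- Every sequence `S 1, …, S (n-1)` of subsets of `{1,…,n}` with
`|⋃_{i=1}^{k} S i| ≤ k` for all `1 ≤ k ≤ n-1` is the encoding of some DAG on
`{1,…,n}`. -/
theorem exists_dag_with_encoding {n : ℕ} (hn : 1 ≤ n) (S : ℕ → Finset (Fin n))
    (hS : ∀ k : ℕ, 1 ≤ k → k ≤ n - 1 → ((Finset.Icc 1 k).biUnion S).card ≤ k) :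
    ∃ E : Fin n → Fin n → Prop, ∃ u : ℕ → Fin n,
      IsDag E ∧ IsMinSourceSeq E u ∧
      ∀ i : ℕ, 1 ≤ i → i ≤ n - 1 → ∀ v : Fin n, (v ∈ S (n - i) ↔ E (u i) v) := by
  set T : ℕ → Finset (Fin n) := fun i => (Finset.Icc 1 (n - i)).biUnion S with hTdef
  set u := greedySeq T ⟨0, hn⟩
  have hmin : ∀ i, 1 ≤ i → i ≤ n →
      IsLeast {v | (∀ j, 1 ≤ j → j < i → v ≠ u j) ∧ v ∉ T i} (u i) := by
    intro i hi hin
    refine isLeast_greedySeq _ hi hin ?_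
    rcases Nat.eq_zero_or_pos (n - i) with h | h
    · simp [hTdef, h]
    · exact hS _ h (by omega)
  have hmemT : ∀ i v, v ∈ T i ↔ ∃ k, (1 ≤ k ∧ k ≤ n - i) ∧ v ∈ S k := by simp [hTdef]
  have hne : ∀ i j, 1 ≤ j → j < i → i ≤ n → u i ≠ u j := fun i j hj hji hin =>
    (hmin i (by omega) hin).1.1 j hj hji
  have hsurj := exists_eq_of_pairwise_ne hne
  have hinj : ∀ i j, 1 ≤ i → i ≤ n → 1 ≤ j → j ≤ n → u i = u j → i = j := by grind
  choose r hr₁ hrn hr using hsurj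
  have hru : ∀ i, 1 ≤ i → i ≤ n → r (u i) = i := fun i hi hin =>
    (hinj i _ hi hin (hr₁ _) (hrn _) (hr (u i))).symm
  refine ⟨fun x v => r x < n ∧ v ∈ S (n - r x), u, ?_, ?_, ?_⟩
  · refine IsDag.of_rank r fun x y hxy => ?_
    by_contra! hle
    have hy := (hmin (r y) (hr₁ y) (hrn y)).1.2
    rw [← hr y, hmemT] at hy
    exact hy ⟨n - r x, by omega, hxy.2⟩
  · intro i hi hin
    convert hmin i hi hin using 1
    ext v
    simp only [Set.mem_ofPred_eq, hmemT]
    refine and_congr_right fun _ => ⟨?_, ?_⟩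
    · rintro h ⟨k, hk, hv⟩
      refine h (u (n - k)) (fun j hj hji => hne _ _ hj (by omega) (by omega)) ?_
      rw [hru _ (by omega) (by omega), Nat.sub_sub_self (by omega)]
      exact ⟨by omega, hv⟩
    · rintro h w hw ⟨hlt, hv⟩
      have hle : i ≤ r w := by
        by_contra! hlt'
        exact hw (r w) (hr₁ w) hlt' (hr w)
      exact h ⟨n - r w, by omega, hv⟩
  · intro i hi hin v
    have hlt : i < n := by omega
    simp [hru i hi hlt.le, hlt]
end

section
/- The number of directed acyclic graphs on n labeled vertices equals the number of sequences S_1, …, S_{n-1} of subsets of {1, 2, …, n} satisfying |⋃_{i=1}^{k} S_i| ≤ k for every 1 ≤ k ≤ n−1. That is, the cardinality of the set of relations E on {1, …, n} whose transitive closure is irreflexive equals the cardinality of the set of such sequences of subsets. -/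
open Relation

/-- Acyclic relations whose edges lie inside `A`. -/
abbrev DagOn {α : Type*} (A : Finset α) : Type _ :=
  {E : α → α → Prop // (∀ x y, E x y → x ∈ A ∧ y ∈ A) ∧ ∀ v, ¬ TransGen E v v}

/-- Sequences of `m` subsets of `A` whose first `k` terms cover at most `k` elements. -/
abbrev SparseSeq {α : Type*} [DecidableEq α] (A : Finset α) (m : ℕ) : Type _ :=
  {S : Fin m → Finset α // (∀ i, S i ⊆ A) ∧ ∀ k : ℕ, 1 ≤ k → k ≤ m →
    ((Finset.univ.filter fun i : Fin m => (i : ℕ) < k).biUnion S).card ≤ k}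

namespace DagOn

variable {α : Type*} {A : Finset α}

open Classical in
/-- The vertices of `A` without outgoing edges. -/
noncomputable def sinks (E : DagOn A) : Finset α :=
  A.filter fun x => ∀ y, ¬ E.1 x y

theorem mem_sinks {E : DagOn A} {x : α} : x ∈ E.sinks ↔ x ∈ A ∧ ∀ y, ¬ E.1 x y := by
  simp [sinks]

theorem sinks_nonempty (E : DagOn A) (hA : A.Nonempty) : E.sinks.Nonempty := by
  let r : A → A → Prop := fun x y => TransGen E.1 y x
  have : IsTrans A r := ⟨fun a b c hab hbc => TransGen.trans hbc hab⟩
  have : Std.Irrefl r := ⟨fun a h => E.2.2 _ h⟩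
  have hwf : WellFounded r := Finite.wellFounded_of_trans_of_irrefl r
  obtain ⟨m, -, hm⟩ := hwf.has_min Set.univ ⟨⟨hA.choose, hA.choose_spec⟩, trivial⟩
  refine ⟨m, mem_sinks.2 ⟨m.2, fun y hy => ?_⟩⟩
  exact hm ⟨y, (E.2.1 _ _ hy).2⟩ trivial (TransGen.single hy)

/-- Adding a new sink to an acyclic relation does not create a cycle. -/
theorem not_transGen_of_sink {E F : α → α → Prop} {v : α} (hE : ∀ x, ¬ TransGen E x x)
    (hv : ∀ y, ¬ F v y) (hF : ∀ x y, F x y → y ≠ v → E x y) (x : α) : ¬ TransGen F x x := by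
  have key : ∀ y, TransGen F x y → y ≠ v → TransGen E x y := by
    intro y h
    induction h with
    | single h => exact fun hy => .single (hF _ _ h hy)
    | tail _ h ih => exact fun hy => .tail (ih fun hb => hv _ (hb ▸ h)) (hF _ _ h hy)
  intro h
  by_cases hx : x = v
  · obtain ⟨y, hy, -⟩ := TransGen.head'_iff.1 h
    exact hv y (hx ▸ hy)
  · exact hE x (key x h hx)

variable [DecidableEq α]

open Classical in
/-- Removing a sink `v` and remembering its set of parents. -/
noncomputable def eraseSinkEquiv {v : α} {Z : Finset α} (hv : v ∈ A) (hZ : v ∈ Z) :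
    {E : DagOn A // E.sinks = Z} ≃
      {p : DagOn (A.erase v) × Finset α // p.2 ⊆ A.erase v ∧ p.1.sinks \ p.2 = Z.erase v} where
  toFun E := by
    have hs : ∀ y, ¬ E.1.1 v y := (mem_sinks.1 (E.2.symm ▸ hZ)).2
    have hs' : ∀ x y, E.1.1 x y → x ≠ v := by rintro x y h rfl; exact hs y h
    refine ⟨(⟨fun x y => E.1.1 x y ∧ y ≠ v, fun x y h => ?_, fun x h => ?_⟩,
      (A.erase v).filter (E.1.1 · v)), Finset.filter_subset _ _, ?_⟩
    · have := E.1.2.1 x y h.1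
      have := hs' x y h.1
      simp_all
    · exact E.1.2.2 x (TransGen.mono (fun _ _ h => h.1) _ _ h)
    · ext x
      simp only [Finset.mem_sdiff, mem_sinks, Finset.mem_erase, Finset.mem_filter, ← E.2]
      constructor
      · rintro ⟨⟨⟨h1, h2⟩, h3⟩, h4⟩
        refine ⟨h1, h2, fun y hy => ?_⟩
        by_cases hyv : y = v
        · exact h4 ⟨⟨h1, h2⟩, hyv ▸ hy⟩
        · exact h3 y ⟨hy, hyv⟩
      · rintro ⟨h1, h2, h3⟩
        exact ⟨⟨⟨h1, h2⟩, fun y hy => h3 y hy.1⟩, fun h => h3 v h.2⟩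
  invFun p := by
    have hp := p.2.1
    have hv1 : ∀ x y, p.1.1.1 x y → x ≠ v ∧ x ∈ A ∧ y ≠ v ∧ y ∈ A := fun x y h => by
      simpa [and_assoc] using p.1.1.2.1 x y h
    have hp' : ∀ x ∈ p.1.2, x ≠ v ∧ x ∈ A := fun x h => by simpa using hp h
    have hs : ∀ y, ¬ (p.1.1.1 v y ∨ (y = v ∧ v ∈ p.1.2)) := by
      rintro y (h | h)
      · exact (hv1 _ _ h).1 rfl
      · exact (hp' _ h.2).1 rfl
    refine ⟨⟨fun x y => p.1.1.1 x y ∨ (y = v ∧ x ∈ p.1.2), ?_, ?_⟩, ?_⟩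
    · rintro x y (h | ⟨rfl, h⟩)
      · exact ⟨(hv1 _ _ h).2.1, (hv1 _ _ h).2.2.2⟩
      · exact ⟨(hp' _ h).2, hv⟩
    · exact not_transGen_of_sink p.1.1.2.2 hs fun x y h hy => h.resolve_right fun h => hy h.1
    · ext x
      by_cases hx : x = v
      · subst hx
        exact iff_of_true (mem_sinks.2 ⟨hv, hs⟩) hZ
      · have h := Finset.ext_iff.1 p.2.2 x
        simp only [Finset.mem_sdiff, mem_sinks, Finset.mem_erase] at h
        rw [mem_sinks]
        constructor
        · rintro ⟨h1, h2⟩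
          exact (h.1 ⟨⟨⟨hx, h1⟩, fun y hy => h2 y (.inl hy)⟩, fun h => h2 v (.inr ⟨rfl, h⟩)⟩).2
        · intro hxZ
          obtain ⟨⟨⟨-, h1⟩, h2⟩, h3⟩ := h.2 ⟨hx, hxZ⟩
          exact ⟨h1, fun y hy => hy.elim (h2 y) fun h => h3 h.2⟩
  left_inv E := by
    have hs : ∀ y, ¬ E.1.1 v y := (mem_sinks.1 (E.2.symm ▸ hZ)).2
    refine Subtype.ext (Subtype.ext ?_)
    funext x y
    refine propext ⟨?_, fun h => ?_⟩
    · rintro (h | ⟨rfl, h⟩)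
      · exact h.1
      · exact (Finset.mem_filter.1 h).2
    · by_cases hy : y = v
      · subst hy
        refine .inr ⟨rfl, Finset.mem_filter.2 ⟨Finset.mem_erase.2 ⟨?_, (E.1.2.1 _ _ h).1⟩, h⟩⟩
        rintro rfl
        exact hs _ h
      · exact .inl ⟨h, hy⟩
  right_inv p := by
    have hv1 : ∀ x y, p.1.1.1 x y → y ≠ v := fun x y h =>
      (Finset.mem_erase.1 (p.1.1.2.1 x y h).2).1
    refine Subtype.ext (Prod.ext (Subtype.ext ?_) ?_)
    · funext x y
      refine propext ⟨fun h => h.1.resolve_right fun h' => h.2 h'.1, fun h => ⟨.inl h, hv1 x y h⟩⟩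
    · ext x
      refine (@Finset.mem_filter _ _ (_) _ _).trans ⟨fun h => ?_, fun h => ⟨p.2.1 h, .inr ⟨rfl, h⟩⟩⟩
      exact (h.2.resolve_left fun h' => hv1 _ _ h' rfl).2

end DagOn

namespace SparseSeq

variable {α : Type*} [DecidableEq α] {A : Finset α} {m : ℕ}

/-- The elements of `A` that no term of the sequence contains. -/
def uncovered (S : SparseSeq A m) : Finset α :=
  A \ Finset.univ.biUnion S.1

theorem mem_uncovered {S : SparseSeq A m} {x : α} :
    x ∈ S.uncovered ↔ x ∈ A ∧ ∀ i, x ∉ S.1 i := by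
  simp [uncovered]

theorem uncovered_nonempty (S : SparseSeq A m) (hA : m < A.card) : S.uncovered.Nonempty := by
  rw [uncovered, Finset.sdiff_nonempty]
  intro h
  have h1 := Finset.card_le_card h
  rcases Nat.eq_zero_or_pos m with rfl | hm
  · simp at h1
    simp [h1] at hA
  · have h2 := S.2.2 m hm le_rfl
    simp only [Fin.is_lt, Finset.filter_true] at h2
    omega

theorem biUnion_lt_snoc_of_le (S : Fin m → Finset α) (P : Finset α) {k : ℕ} (hk : k ≤ m) :
    (Finset.univ.filter fun i : Fin (m + 1) => (i : ℕ) < k).biUnion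
        (Fin.snoc S P : Fin (m + 1) → Finset α) =
      (Finset.univ.filter fun i : Fin m => (i : ℕ) < k).biUnion S := by
  ext x
  simp [Fin.exists_fin_succ', hk]

/-- Removing the last term of a sequence that avoids `v`. -/
def initEquiv {v : α} {Z : Finset α} (hA : A.card = m + 2) (hv : v ∈ A) (hZ : v ∈ Z) :
    {S : SparseSeq A (m + 1) // S.uncovered = Z} ≃
      {p : SparseSeq (A.erase v) m × Finset α //
        p.2 ⊆ A.erase v ∧ p.1.uncovered \ p.2 = Z.erase v} where
  toFun S := by
    have hs : ∀ i, v ∉ S.1.1 i := (mem_uncovered.1 (S.2.symm ▸ hZ)).2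
    have hS : ∀ i, S.1.1 i ⊆ A.erase v := fun i =>
      Finset.subset_erase.2 ⟨S.1.2.1 i, hs i⟩
    refine ⟨(⟨Fin.init S.1.1, fun i => hS _, fun k hk hkm => ?_⟩, S.1.1 (Fin.last m)), hS _, ?_⟩
    · rw [← biUnion_lt_snoc_of_le _ (S.1.1 (Fin.last m)) hkm, Fin.snoc_init_self]
      exact S.1.2.2 k hk (by omega)
    · ext x
      simp only [Finset.mem_sdiff, mem_uncovered, Finset.mem_erase, ← S.2, Fin.forall_fin_succ',
        Fin.init]
      tauto
  invFun p := by
    have hp := p.2.1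
    refine ⟨⟨Fin.snoc p.1.1.1 p.1.2, ?_, fun k hk hkm => ?_⟩, ?_⟩
    · have h := p.1.1.2.1
      simp only [Fin.forall_fin_succ', Fin.snoc_castSucc, Fin.snoc_last]
      exact ⟨fun i => (h i).trans (Finset.erase_subset _ _), hp.trans (Finset.erase_subset _ _)⟩
    · rcases Nat.lt_or_ge m k with h | h
      · have hsub : (Finset.univ.filter fun i : Fin (m + 1) => (i : ℕ) < k).biUnion
            (Fin.snoc p.1.1.1 p.1.2 : Fin (m + 1) → Finset α) ⊆ A.erase v := by
          refine Finset.biUnion_subset.2 fun i _ => ?_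
          induction i using Fin.lastCases with
          | last => simpa using hp
          | cast i => simpa using p.1.1.2.1 i
        have := Finset.card_le_card hsub
        rw [Finset.card_erase_of_mem hv] at this
        omega
      · rw [biUnion_lt_snoc_of_le _ _ h]
        exact p.1.1.2.2 k hk h
    · ext x
      have h := Finset.ext_iff.1 p.2.2 x
      simp only [Finset.mem_sdiff, mem_uncovered, Finset.mem_erase] at h
      simp only [mem_uncovered, Fin.forall_fin_succ', Fin.snoc_castSucc, Fin.snoc_last]
      by_cases hx : x = v
      · subst hx
        refine iff_of_true ⟨hv, fun i hi => ?_, fun hi => ?_⟩ hZ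
        · simpa using p.1.1.2.1 i hi
        · simpa using hp hi
      · tauto
  left_inv S := Subtype.ext (Subtype.ext (Fin.snoc_init_self _))
  right_inv p := Subtype.ext <| Prod.ext (Subtype.ext (Fin.init_snoc (α := fun _ => Finset α) _ _))
    (Fin.snoc_last (α := fun _ => Finset α) _ _)

end SparseSeq

/-- Sinks of acyclic relations and uncovered elements of sparse sequences are equidistributed. -/
theorem exists_dagOn_equiv_sparseSeq {α : Type*} [DecidableEq α] (m : ℕ) (A : Finset α)
    (hA : A.card = m + 1) :
    ∃ φ : DagOn A ≃ SparseSeq A m, ∀ E, (φ E).uncovered = E.sinks := by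
  induction m generalizing A with
  | zero =>
    obtain ⟨a, rfl⟩ := Finset.card_eq_one.1 hA
    have hD : ∀ (E : DagOn {a}) x y, ¬ E.1 x y := fun E x y h => by
      have h' := E.2.1 x y h
      simp only [Finset.mem_singleton] at h'
      obtain ⟨rfl, rfl⟩ := h'
      exact E.2.2 _ (.single h)
    refine ⟨⟨fun _ => ⟨Fin.elim0, fun i => i.elim0, by omega⟩,
      fun _ => ⟨fun _ _ => False, by simp, fun v h => ?_⟩, fun E => ?_, fun S => ?_⟩, fun E => ?_⟩
    · obtain ⟨y, hy, -⟩ := TransGen.head'_iff.1 h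
      exact hy
    · refine Subtype.ext ?_
      funext x y
      exact propext (iff_of_false id (hD E x y))
    · exact Subtype.ext (Subsingleton.elim _ _)
    · ext x
      simp [DagOn.mem_sinks, SparseSeq.mem_uncovered, hD E]
  | succ m ih =>
    have key : ∀ Z, Nonempty ({E : DagOn A // E.sinks = Z} ≃
        {S : SparseSeq A (m + 1) // S.uncovered = Z}) := by
      intro Z
      by_cases h : ∃ v ∈ Z, v ∈ A
      · obtain ⟨v, hZ, hv⟩ := h
        obtain ⟨φ, hφ⟩ := ih (A.erase v) (by rw [Finset.card_erase_of_mem hv, hA]; rfl)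
        exact ⟨(DagOn.eraseSinkEquiv hv hZ).trans <|
          ((φ.prodCongr (Equiv.refl _)).subtypeEquiv (by simp [hφ])).trans
          (SparseSeq.initEquiv hA hv hZ).symm⟩
      · have hE : IsEmpty {E : DagOn A // E.sinks = Z} := ⟨fun E => by
          obtain ⟨x, hx⟩ := E.1.sinks_nonempty (Finset.card_pos.1 (by omega))
          exact h ⟨x, E.2 ▸ hx, (DagOn.mem_sinks.1 hx).1⟩⟩
        have hS : IsEmpty {S : SparseSeq A (m + 1) // S.uncovered = Z} := ⟨fun S => by
          obtain ⟨x, hx⟩ := S.1.uncovered_nonempty (by omega)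
          exact h ⟨x, S.2 ▸ hx, (SparseSeq.mem_uncovered.1 hx).1⟩⟩
        exact ⟨Equiv.equivOfIsEmpty _ _⟩
    exact ⟨Equiv.ofFiberEquiv fun Z => (key Z).some, Equiv.ofFiberEquiv_map _⟩

/-- The number of DAGs on `n` labeled vertices (relations on `{1,…,n}`
whose transitive closure is irreflexive) equals the number of sequences
`S_1,…,S_{n-1}` of subsets of `{1,…,n}` with `|⋃_{i=1}^{k} S_i| ≤ k` for every
`1 ≤ k ≤ n-1`. (Here `S i` for `i : Fin (n-1)` represents `S_{i+1}`.) -/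
theorem card_dags_eq_card_sequences (n : ℕ) :
    Nat.card {E : Fin n → Fin n → Prop // ∀ v : Fin n, ¬ Relation.TransGen E v v} =
    Nat.card {S : Fin (n - 1) → Finset (Fin n) //
      ∀ k : ℕ, 1 ≤ k → k ≤ n - 1 →
        ((Finset.univ.filter fun i : Fin (n - 1) => (i : ℕ) < k).biUnion S).card ≤ k} := by
  cases n with
  | zero =>
    refine Nat.card_congr ⟨fun _ => ⟨Fin.elim0, by omega⟩, fun _ => ⟨fun i => i.elim0,
      fun i => i.elim0⟩, fun E => Subtype.ext (Subsingleton.elim _ _),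
      fun S => Subtype.ext (funext fun i => i.elim0)⟩
  | succ m =>
    obtain ⟨φ, -⟩ := exists_dagOn_equiv_sparseSeq m (Finset.univ : Finset (Fin (m + 1))) (by simp)
    exact Nat.card_congr <|
      (Equiv.subtypeEquivRight fun E => by simp).trans <| φ.trans <|
        Equiv.subtypeEquivRight fun S => by simp
end

section
/- Let a_n denote the number of sequences S_1, …, S_{n-1} of subsets of {1, 2, …, n} with the property that |⋃_{i=1}^{k} S_i| ≤ k for every 1 ≤ k ≤ n−1 (with a_0 = 1). Then for every n ≥ 1: a_n = ∑_{k=1}^{n} (−1)^{k−1} · C(n, k) · 2^{k(n−k)} · a_{n−k}. -/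
/-- `a n` is the number of tuples `(S_1,…,S_{n-1})` of subsets of `{1,…,n}` such
that `|⋃_{i=1}^{k} S_i| ≤ k` for every `1 ≤ k ≤ n-1` (here `S i` for
`i : Fin (n-1)` represents `S_{i+1}`); in particular `a 0 = 1`. -/
noncomputable def seqCount (n : ℕ) : ℕ :=
  Nat.card {S : Fin (n - 1) → Finset (Fin n) //
    ∀ k : ℕ, 1 ≤ k → k ≤ n - 1 →
      ((Finset.univ.filter fun i : Fin (n - 1) => (i : ℕ) < k).biUnion S).card ≤ k}

section

open Finset

/-- A family `f` of finite sets of naturals, seen as binary expansions, is a parking function on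
`A` for the bounds `1, 2, 4, …`: for every `m < #A`, more than `m` of its values on `A` lie
below `2 ^ m`. -/
def IsBinaryParking {ι : Type*} (A : Finset ι) (f : ι → Finset ℕ) : Prop :=
  ∀ m < #A, m < #{i ∈ A | f i ⊆ range m}

/-- `f` is a parking function on `A`, and its values outside `A` lie below `2 ^ #A`. -/
def IsParkingSupport {ι : Type*} (A : Finset ι) (f : ι → Finset ℕ) : Prop :=
  IsBinaryParking A f ∧ ∀ i ∉ A, f i ⊆ range #A

theorem isBinaryParking_map {ι κ : Type*} (φ : κ ↪ ι) (A : Finset κ) (f : ι → Finset ℕ) :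
    IsBinaryParking (A.map φ) f ↔ IsBinaryParking A (f ∘ φ) := by
  simp [IsBinaryParking, filter_map]

theorem card_filter_subset_range_add_card_biUnion {k : ℕ} (g : Fin k → Finset ℕ)
    (hg : ∀ i, g i ⊆ range (k - 1)) (S : Fin (k - 1) → Finset (Fin k))
    (hS : ∀ t i, i ∈ S t ↔ (t.rev : ℕ) ∈ g i) (q : ℕ) :
    #{i | g i ⊆ range (k - 1 - q)} +
      #((univ.filter fun t : Fin (k - 1) => (t : ℕ) < q).biUnion S) = k := by
  have h : (univ.filter fun t : Fin (k - 1) => (t : ℕ) < q).biUnion S =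
      univ.filter fun i => ¬ g i ⊆ range (k - 1 - q) := by
    ext i
    simp only [mem_biUnion, mem_filter, mem_univ, true_and, hS, not_subset, mem_range]
    constructor
    · rintro ⟨t, ht, hi⟩
      refine ⟨_, hi, ?_⟩
      rw [Fin.val_rev]
      omega
    · rintro ⟨x, hx, hxq⟩
      have hxk := mem_range.1 (hg i hx)
      refine ⟨(⟨x, hxk⟩ : Fin (k - 1)).rev, ?_, by simpa using hx⟩
      rw [Fin.val_rev]
      dsimp only
      omega
  rw [h, card_filter_add_card_filter_not]
  simp

theorem IsBinaryParking.subset_range {k : ℕ} {g : Fin k → Finset ℕ}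
    (hg : IsBinaryParking univ g) (i : Fin k) : g i ⊆ range (k - 1) := by
  have hk := i.pos
  have h := hg (k - 1) (by rw [card_fin]; omega)
  have h' : #{i | g i ⊆ range (k - 1)} = #(univ : Finset (Fin k)) :=
    le_antisymm (card_filter_le _ _) (by rw [card_fin]; omega)
  exact filter_eq_self.1 (eq_of_subset_of_card_le (filter_subset _ _) h'.ge) i (mem_univ i)

theorem isBinaryParking_univ_iff {k : ℕ} (g : Fin k → Finset ℕ)
    (hg : ∀ i, g i ⊆ range (k - 1)) (S : Fin (k - 1) → Finset (Fin k))
    (hS : ∀ t i, i ∈ S t ↔ (t.rev : ℕ) ∈ g i) :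
    IsBinaryParking univ g ↔ ∀ q : ℕ, 1 ≤ q → q ≤ k - 1 →
      #((univ.filter fun t : Fin (k - 1) => (t : ℕ) < q).biUnion S) ≤ q := by
  constructor
  · intro h q h1 hq
    have := card_filter_subset_range_add_card_biUnion g hg S hS q
    have := h (k - 1 - q) (by rw [card_fin]; omega)
    omega
  · intro h m hm
    rw [card_fin] at hm
    obtain rfl | hmk : m = k - 1 ∨ m < k - 1 := by omega
    · rw [filter_true_of_mem fun i _ => hg i, card_fin]
      exact hm
    · have h1 := card_filter_subset_range_add_card_biUnion g hg S hS (k - 1 - m)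
      have h2 := h (k - 1 - m) (by omega) (by omega)
      rw [show k - 1 - (k - 1 - m) = m by omega] at h1
      omega

theorem card_isBinaryParking_fin (k : ℕ) :
    Nat.card {g : Fin k → Finset ℕ // IsBinaryParking univ g} = seqCount k := by
  let row (S : Fin (k - 1) → Finset (Fin k)) (i : Fin k) : Finset ℕ :=
    (univ.filter fun t => i ∈ S t).image fun t => (t.rev : ℕ)
  have row_subset (S) (i) : row S i ⊆ range (k - 1) := by
    intro x hx
    obtain ⟨t, -, rfl⟩ := mem_image.1 hx
    exact mem_range.2 t.rev.isLt
  have mem_row (S) (t : Fin (k - 1)) (i) : i ∈ S t ↔ (t.rev : ℕ) ∈ row S i := by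
    simp only [row, mem_image, mem_filter, mem_univ, true_and, Fin.val_inj, Fin.rev_inj,
      exists_eq_right]
  have mem_col (g : Fin k → Finset ℕ) (t : Fin (k - 1)) (i) :
      i ∈ (univ.filter fun i => (t.rev : ℕ) ∈ g i) ↔ (t.rev : ℕ) ∈ g i := by simp
  refine Nat.card_congr
    { toFun := fun g => ⟨fun t => univ.filter fun i => (t.rev : ℕ) ∈ g.1 i,
        (isBinaryParking_univ_iff g.1 g.2.subset_range _ (mem_col g.1)).1 g.2⟩
      invFun := fun S => ⟨row S.1,
        (isBinaryParking_univ_iff _ (row_subset S.1) S.1 (mem_row S.1)).2 S.2⟩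
      left_inv := ?_
      right_inv := ?_ }
  · rintro ⟨g, hg⟩
    ext i x
    simp only [row, mem_image, mem_filter, mem_univ, true_and]
    constructor
    · rintro ⟨t, ht, rfl⟩
      exact ht
    · intro hx
      exact ⟨(⟨x, mem_range.1 (hg.subset_range i hx)⟩ : Fin (k - 1)).rev,
        by simpa using hx, by simp⟩
  · rintro ⟨S, hS⟩
    ext t i
    exact mem_filter_univ i |>.trans (mem_row S t i).symm

theorem card_isBinaryParking_univ (ι : Type*) [Fintype ι] :
    Nat.card {g : ι → Finset ℕ // IsBinaryParking univ g} = seqCount (Fintype.card ι) := by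
  rw [← card_isBinaryParking_fin]
  let e := Fintype.equivFin ι
  refine Nat.card_congr (Equiv.subtypeEquiv (e.arrowCongr (Equiv.refl _)) fun g => ?_)
  have h := isBinaryParking_map e.symm.toEmbedding univ g
  rw [map_univ_equiv] at h
  exact h

theorem card_isParkingSupport {ι : Type*} [Fintype ι] [DecidableEq ι] (A : Finset ι) :
    Nat.card {f : ι → Finset ℕ // IsParkingSupport A f} =
      seqCount (#A) * 2 ^ (#A * (Fintype.card ι - #A)) := by
  have e : {f : ι → Finset ℕ // IsParkingSupport A f} ≃
      {g : {i // i ∈ A} → Finset ℕ // IsBinaryParking univ g} ×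
        ({i // i ∉ A} → {R : Finset ℕ // R ⊆ range #A}) :=
    ((Equiv.subtypeEquiv (q := fun p => IsBinaryParking univ p.1 ∧ ∀ i, p.2 i ⊆ range #A)
      (Equiv.piEquivPiSubtypeProd (· ∈ A) fun _ => Finset ℕ) fun f => by
        have h := isBinaryParking_map (Function.Embedding.subtype (· ∈ A)) univ f
        rw [univ_eq_attach, attach_map_val] at h
        simp [IsParkingSupport, h, Equiv.piEquivPiSubtypeProd, Function.comp_def]).trans
      (Equiv.subtypeProdEquivProd (p := fun g : {i // i ∈ A} → Finset ℕ => IsBinaryParking univ g)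
        (q := fun g : {i // i ∉ A} → Finset ℕ => ∀ i, g i ⊆ range #A))).trans
      (Equiv.prodCongr (Equiv.refl _) Equiv.subtypePiEquivPi)
  have hR : Nat.card {R : Finset ℕ // R ⊆ range #A} = 2 ^ #A := by
    rw [Nat.subtype_card (range #A).powerset fun R => mem_powerset, card_powerset, card_range]
  rw [Nat.card_congr e, Nat.card_prod, card_isBinaryParking_univ, Nat.card_fun, hR, pow_mul]
  simp [Fintype.card_subtype_compl]

theorem subset_range_iff_sup_le (R : Finset ℕ) (m : ℕ) :
    R ⊆ range m ↔ R.sup Nat.succ ≤ m := by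
  simp [subset_iff, Finset.sup_le_iff]

/-- An index carrying the largest value can be moved freely into and out of the parking set. -/
theorem isParkingSupport_insert_iff {ι : Type*} [DecidableEq ι] {f : ι → Finset ℕ}
    {i : ι} (hi : ∀ j m, f i ⊆ range m → f j ⊆ range m) {A : Finset ι} (hA : i ∉ A) :
    IsParkingSupport (insert i A) f ↔ IsParkingSupport A f := by
  have hc : #(insert i A) = #A + 1 := card_insert_of_notMem hA
  constructor
  · rintro ⟨h, -⟩
    have hlast : f i ⊆ range #A := by
      have h1 := h #A (by omega)
      have h2 := card_filter_le (insert i A) fun j => f j ⊆ range #A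
      have h3 := eq_of_subset_of_card_le
        (filter_subset (fun j => f j ⊆ range #A) (insert i A)) (by omega)
      exact filter_eq_self.1 h3 i (mem_insert_self _ _)
    refine ⟨fun m hm => ?_, fun j _ => hi j _ hlast⟩
    by_cases him : f i ⊆ range m
    · rwa [filter_true_of_mem fun j _ => hi j m him]
    · have := h m (by omega)
      rwa [filter_insert, if_neg him] at this
  · rintro ⟨h, hout⟩
    have hlast := hout i hA
    refine ⟨fun m hm => ?_, fun j _ => hi j _ (hlast.trans ?_)⟩
    · obtain hm | rfl : m < #A ∨ m = #A := by omega
      · exact (h m hm).trans_le (card_le_card (filter_subset_filter _ (subset_insert _ _)))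
      · rw [filter_true_of_mem fun j _ => hi j _ hlast]
        exact hm
    · exact range_subset_range.2 (by omega)

open Classical in
theorem sum_neg_one_pow_isParkingSupport {ι : Type*} [Fintype ι] [Nonempty ι]
    (f : ι → Finset ℕ) :
    ∑ A : Finset ι, (if IsParkingSupport A f
      then (-1 : ℤ) ^ #A else 0) = 0 := by
  obtain ⟨i, hi⟩ := Finite.exists_max fun j => (f j).sup Nat.succ
  have hmax (j m) (h : f i ⊆ range m) : f j ⊆ range m := by
    rw [subset_range_iff_sup_le] at h ⊢
    exact (hi j).trans h
  have hu : (univ : Finset (Finset ι)) = (insert i (univ.erase i)).powerset := by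
    rw [insert_erase (mem_univ i), powerset_univ]
  rw [hu, sum_powerset_insert (notMem_erase i _), ← sum_add_distrib]
  refine sum_eq_zero fun A hA => ?_
  have hiA : i ∉ A := fun h => notMem_erase i _ (mem_powerset.1 hA h)
  simp only [isParkingSupport_insert_iff hmax hiA, card_insert_of_notMem hiA]
  split_ifs <;> ring

theorem sum_neg_one_pow_mul_seqCount (n : ℕ) (hn : 1 ≤ n) :
    ∑ k ∈ range (n + 1), (n.choose k : ℤ) * ((-1) ^ k * (seqCount k * 2 ^ (k * (n - k)))) = 0 := by
  classical
  have : Nonempty (Fin n) := ⟨⟨0, hn⟩⟩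
  let F : Finset (Fin n → Finset ℕ) := Fintype.piFinset fun _ => (range n).powerset
  have hcard (A : Finset (Fin n)) :
      #{f ∈ F | IsParkingSupport A f} = seqCount (#A) * 2 ^ (#A * (n - #A)) := by
    have h := card_isParkingSupport A
    rw [Fintype.card_fin] at h
    rw [← h]
    refine (Nat.subtype_card _ fun f => ?_).symm
    simp only [mem_filter, and_iff_right_iff_imp, F, Fintype.mem_piFinset, mem_powerset]
    rintro ⟨hf, hout⟩ i
    have hAn : range #A ⊆ range n := range_subset_range.2 (by simpa using card_le_univ A)
    by_cases hi : i ∈ A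
    · have hpos := card_pos.2 ⟨i, hi⟩
      have h1 := hf (#A - 1) (by omega)
      have h2 := eq_of_subset_of_card_le
        (filter_subset (fun j => f j ⊆ range (#A - 1)) A) (by omega)
      exact (filter_eq_self.1 h2 i hi).trans ((range_subset_range.2 (by omega)).trans hAn)
    · exact (hout i hi).trans hAn
  have hsum : ∑ A : Finset (Fin n), (-1 : ℤ) ^ #A * (seqCount (#A) * 2 ^ (#A * (n - #A))) = 0 := by
    calc _ = ∑ A : Finset (Fin n), ∑ f ∈ F,
          (if IsParkingSupport A f then (-1 : ℤ) ^ #A else 0) := by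
          refine sum_congr rfl fun A _ => ?_
          rw [← sum_filter, sum_const, hcard, nsmul_eq_mul]
          push_cast
          ring
      _ = 0 := by
          rw [sum_comm]
          exact sum_eq_zero fun f _ => sum_neg_one_pow_isParkingSupport f
  rw [← powerset_univ, sum_powerset_apply_card
    (fun k => (-1 : ℤ) ^ k * (seqCount k * 2 ^ (k * (n - k)))), card_fin] at hsum
  simpa only [nsmul_eq_mul] using hsum

end

/-- Robinson's recursion holds for the sequence counts:
`a_n = ∑_{k=1}^{n} (-1)^{k-1} C(n,k) 2^{k(n-k)} a_{n-k}` for every `n ≥ 1`. -/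
theorem seqCount_recursion (n : ℕ) (hn : 1 ≤ n) :
    (seqCount n : ℤ) =
      ∑ k ∈ Finset.Icc 1 n,
        (-1 : ℤ) ^ (k - 1) * (n.choose k) * 2 ^ (k * (n - k)) * seqCount (n - k) := by
  have hterm (k : ℕ) (hk : k ∈ Finset.Icc 1 n) :
      (n.choose (n - k) : ℤ) * ((-1) ^ (n - k) *
        (seqCount (n - k) * 2 ^ ((n - k) * (n - (n - k))))) =
      -(-1) ^ n * ((-1 : ℤ) ^ (k - 1) * (n.choose k) * 2 ^ (k * (n - k)) *
        seqCount (n - k)) := by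
    obtain ⟨hk1, hkn⟩ := Finset.mem_Icc.1 hk
    obtain ⟨m, rfl⟩ := Nat.exists_eq_add_of_le hkn
    obtain ⟨j, rfl⟩ := Nat.exists_eq_add_of_le' hk1
    have hsq : (-1 : ℤ) ^ j * (-1) ^ j = 1 := by rw [← mul_pow]; simp
    rw [Nat.choose_symm hkn, Nat.sub_sub_self hkn, Nat.add_sub_cancel_left,
      Nat.add_sub_cancel, mul_comm m, pow_add, pow_add]
    linear_combination (-(((j + 1 + m).choose (j + 1) : ℤ) * (-1) ^ m * seqCount m *
      2 ^ ((j + 1) * m))) * hsq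
  have h := sum_neg_one_pow_mul_seqCount n hn
  rw [← Finset.sum_flip, Finset.range_eq_Ico, Finset.sum_eq_sum_Ico_succ_bot (Nat.succ_pos n),
    zero_add, Nat.succ_eq_add_one, Finset.Ico_add_one_right_eq_Icc,
    Finset.sum_congr rfl hterm, ← Finset.mul_sum] at h
  simp only [tsub_zero, Nat.choose_self, tsub_self, mul_zero, pow_zero, Nat.cast_one, one_mul,
    mul_one] at h
  have hne : (-1 : ℤ) ^ n ≠ 0 := pow_ne_zero _ (by norm_num)
  refine mul_left_cancel₀ hne ?_
  linear_combination h
end
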